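/- arXiv:2306.05009 — 2 statements merged into one kernel-verified Lean document; each statement's English description precedes it below -/
import Mathlib

section
/- Let L > 0, M ∈ ℕ, a_0, …, a_M ∈ ℂ, s ∈ (0, π), x = L·cot(s), and let P ∈ ℕ with P ≥ 2M+1. With b̃, c̃ and (b̃∗c̃)_l defined exactly as follows — b̃_l = (8l+4)·a_l for 0 ≤ l ≤ M and b̃_l = 0 for M+1 ≤ l ≤ P−1; c̃_0 = 1/3, c̃_l = 0 for 1 ≤ l ≤ P−M−1, c̃_l = 1/((2(l−P)−3)(2(l−P)−1)(2(l−P)+1)) for P−M ≤ l ≤ P−1; (b̃∗c̃)_l = ∑_{n=0}^{P−1} b̃_n·c̃_{(l−n) mod P} — one has ∑_{l=0}^{M} a_l·(1/π)·PV∫ u_{−(2l+1)}'(y)/(x−y) dy = (2i/(Lπ))·∑_{l=0}^{M} a_l/(2l+3) − (2i/(Lπ))·∑_{l=0}^{M} (b̃∗c̃)_l·e^{−i2ls} + (2i/(Lπ))·( cos(s) + sin²(s)·ln(cot(s/2)) )·∑_{l=0}^{M} (2l+1)·a_l·e^{−i(2l+1)s}; in particular each principal value on the left exists. -/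
open Filter MeasureTheory

/-- `u_k(y) = (y+iL)^k/(y²+L²)^{k/2}`, with `(y+iL)^k` a `zpow` in `ℂ` and `(y²+L²)^{k/2}` a
real power; for `x = L·cot s`, `(1/π)·PV∫ u_{−k}'(y)/(x−y) dy` is `(−Δ)_s^{1/2} e^{−iks}`. -/
noncomputable def uFunL (L : ℝ) (k : ℤ) (y : ℝ) : ℂ :=
  ((y : ℂ) + Complex.I * (L : ℂ)) ^ k / ((((y ^ 2 + L ^ 2 : ℝ) ^ ((k : ℝ) / 2) : ℝ)) : ℂ)

open scoped Topology

/-- `f` is integrable off every neighbourhood of `x`, and `v` is the limit of its integrals over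
the sets `{y | ε ≤ |x - y|}` as `ε → 0⁺`. -/
def HasPV (x : ℝ) (f : ℝ → ℂ) (v : ℂ) : Prop :=
  (∀ ε > 0, IntegrableOn f {y : ℝ | ε ≤ |x - y|}) ∧
    Tendsto (fun ε : ℝ => ∫ y in {y : ℝ | ε ≤ |x - y|}, f y) (𝓝[>] 0) (𝓝 v)

lemma measurableSet_le_abs_sub (x ε : ℝ) : MeasurableSet {y : ℝ | ε ≤ |x - y|} :=
  measurableSet_le measurable_const (by fun_prop)

namespace HasPV

variable {x : ℝ} {f g : ℝ → ℂ} {v w : ℂ}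

lemma add (hf : HasPV x f v) (hg : HasPV x g w) : HasPV x (fun y => f y + g y) (v + w) := by
  refine ⟨fun ε hε => (hf.1 ε hε).add (hg.1 ε hε), (hf.2.add hg.2).congr' ?_⟩
  filter_upwards [self_mem_nhdsWithin] with ε hε
  exact (integral_add (hf.1 ε hε) (hg.1 ε hε)).symm

lemma const_mul (c : ℂ) (hf : HasPV x f v) : HasPV x (fun y => c * f y) (c * v) := by
  refine ⟨fun ε hε => (hf.1 ε hε).const_mul c, (hf.2.const_mul c).congr fun ε => ?_⟩
  exact (integral_const_mul c _).symm

lemma congr (hf : HasPV x f v) (h : ∀ y, y ≠ x → f y = g y) : HasPV x g v := by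
  have key : ∀ ε > 0, Set.EqOn f g {y : ℝ | ε ≤ |x - y|} := by
    intro ε hε y hy
    refine h y ?_
    rintro rfl
    simp only [Set.mem_ofPred_eq, sub_self, abs_zero] at hy
    linarith
  refine ⟨fun ε hε => (hf.1 ε hε).congr_fun (key ε hε) (measurableSet_le_abs_sub x ε),
    hf.2.congr' ?_⟩
  filter_upwards [self_mem_nhdsWithin] with ε hε
  exact setIntegral_congr_fun (measurableSet_le_abs_sub x ε) (key ε hε)

lemma of_hasDerivAt {F : ℝ → ℂ} {A B d : ℂ}
    (hint : ∀ ε > 0, IntegrableOn f {y : ℝ | ε ≤ |x - y|})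
    (hderiv : ∀ y, y ≠ x → HasDerivAt F (f y) y)
    (hA : Tendsto F atTop (𝓝 A)) (hB : Tendsto F atBot (𝓝 B))
    (hd : Tendsto (fun ε : ℝ => F (x - ε) - F (x + ε)) (𝓝[>] 0) (𝓝 d)) :
    HasPV x f (A - B + d) := by
  refine ⟨hint, (hd.const_add (A - B)).congr' ?_⟩
  filter_upwards [self_mem_nhdsWithin] with ε hε
  have hε' : 0 < ε := hε
  have hset : {y : ℝ | ε ≤ |x - y|} = Set.Iic (x - ε) ∪ Set.Ici (x + ε) := by
    ext y
    simp only [Set.mem_ofPred_eq, Set.mem_union, Set.mem_Iic, Set.mem_Ici, le_abs]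
    constructor <;> rintro (h | h) <;> first | (left; linarith) | (right; linarith)
  have hi := hint ε hε'
  rw [hset] at hi ⊢
  have hdisj : Disjoint (Set.Iic (x - ε)) (Set.Ici (x + ε)) := by
    rw [Set.disjoint_left]
    intro y h1 h2
    simp only [Set.mem_Iic, Set.mem_Ici] at h1 h2
    linarith
  rw [setIntegral_union hdisj measurableSet_Ici hi.left_of_union hi.right_of_union,
    integral_Ici_eq_integral_Ioi,
    integral_Iic_of_hasDerivAt_of_tendsto'
      (fun y hy => hderiv y (by rintro rfl; simp only [Set.mem_Iic] at hy; linarith))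
      hi.left_of_union hB,
    integral_Ioi_of_hasDerivAt_of_tendsto'
      (fun y hy => hderiv y (by rintro rfl; simp only [Set.mem_Ici] at hy; linarith))
      (hi.right_of_union.mono_set Set.Ioi_subset_Ici_self) hA]
  ring

lemma of_integrable_of_hasDerivAt {F : ℝ → ℂ} {A B : ℂ} (hint : Integrable f)
    (hderiv : ∀ y, HasDerivAt F (f y) y)
    (hA : Tendsto F atTop (𝓝 A)) (hB : Tendsto F atBot (𝓝 B)) : HasPV x f (A - B) := by
  have hcont : Continuous F := continuous_iff_continuousAt.2 fun y => (hderiv y).continuousAt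
  have h0 : Tendsto (fun ε : ℝ => F (x - ε) - F (x + ε)) (𝓝[>] 0) (𝓝 0) := by
    have : Continuous fun ε : ℝ => F (x - ε) - F (x + ε) := by fun_prop
    simpa using (this.tendsto 0).mono_left nhdsWithin_le_nhds
  simpa using of_hasDerivAt (fun ε _ => hint.integrableOn) (fun y _ => hderiv y) hA hB h0

end HasPV

section Sqrt

variable {L : ℝ}

lemma hasDerivAt_sqrt_sq_add_sq (hL : 0 < L) (y : ℝ) :
    HasDerivAt (fun y : ℝ => √(y ^ 2 + L ^ 2)) (y / √(y ^ 2 + L ^ 2)) y := by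
  have h : HasDerivAt (fun y : ℝ => y ^ 2 + L ^ 2) (2 * y) y := by
    simpa using (hasDerivAt_pow 2 y).add_const (L ^ 2)
  convert h.sqrt (by positivity) using 1
  field_simp

lemma tendsto_inv_sqrt_sq_add_sq_atTop (L : ℝ) :
    Tendsto (fun y : ℝ => (√(y ^ 2 + L ^ 2))⁻¹) atTop (𝓝 0) := by
  refine Tendsto.inv_tendsto_atTop (tendsto_atTop_mono (fun y => ?_) tendsto_id)
  exact Real.le_sqrt_of_sq_le (by simp; positivity)

lemma tendsto_inv_sqrt_sq_add_sq_atBot (L : ℝ) :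
    Tendsto (fun y : ℝ => (√(y ^ 2 + L ^ 2))⁻¹) atBot (𝓝 0) := by
  simpa [Function.comp_def] using
    (tendsto_inv_sqrt_sq_add_sq_atTop L).comp tendsto_neg_atBot_atTop

lemma tendsto_div_sqrt_sq_add_sq_atTop (hL : 0 < L) :
    Tendsto (fun y : ℝ => y / √(y ^ 2 + L ^ 2)) atTop (𝓝 1) := by
  have h : Tendsto (fun y : ℝ => √(1 - L ^ 2 * ((√(y ^ 2 + L ^ 2))⁻¹) ^ 2)) atTop (𝓝 1) := by
    simpa using (((tendsto_inv_sqrt_sq_add_sq_atTop L).pow 2).const_mul (L ^ 2)).const_sub 1 |>.sqrt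
  refine h.congr' ?_
  filter_upwards [eventually_ge_atTop 0] with y hy
  have hR : 0 < y ^ 2 + L ^ 2 := by positivity
  rw [inv_pow, Real.sq_sqrt hR.le]
  rw [show 1 - L ^ 2 * (y ^ 2 + L ^ 2)⁻¹ = y ^ 2 / (y ^ 2 + L ^ 2) by field_simp; ring,
    Real.sqrt_div (sq_nonneg y), Real.sqrt_sq hy]

lemma tendsto_div_sqrt_sq_add_sq_atBot (hL : 0 < L) :
    Tendsto (fun y : ℝ => y / √(y ^ 2 + L ^ 2)) atBot (𝓝 (-1)) := by
  simpa [Function.comp_def, neg_div] using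
    ((tendsto_div_sqrt_sq_add_sq_atTop hL).comp tendsto_neg_atBot_atTop).neg

lemma integrable_inv_sq_add_sq (hL : 0 < L) : Integrable fun y : ℝ => (y ^ 2 + L ^ 2)⁻¹ := by
  have h := ((integrable_inv_one_add_sq.comp_div hL.ne').const_mul ((L ^ 2)⁻¹))
  refine h.congr (ae_of_all _ fun y => ?_)
  simp only
  have : 0 < y ^ 2 + L ^ 2 := by positivity
  field_simp
  ring

end Sqrt

/-- The unit complex number `e^{-iη}` at the point `y = L·cot η`. -/
noncomputable def unitPhase (L y : ℝ) : ℂ :=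
  ((y : ℂ) - Complex.I * (L : ℂ)) / ((√(y ^ 2 + L ^ 2) : ℝ) : ℂ)

section UnitPhase

variable {L : ℝ}

lemma ofReal_add_I_mul_ne_zero (hL : 0 < L) (y : ℝ) : (y : ℂ) + Complex.I * (L : ℂ) ≠ 0 := by
  intro h
  have := congrArg Complex.im h
  simp at this
  exact hL.ne' this

lemma ofReal_sqrt_sq (hL : 0 < L) (y : ℝ) :
    ((√(y ^ 2 + L ^ 2) : ℝ) : ℂ) ^ 2 = (y : ℂ) ^ 2 + (L : ℂ) ^ 2 := by
  have h : (√(y ^ 2 + L ^ 2)) ^ 2 = y ^ 2 + L ^ 2 := Real.sq_sqrt (by positivity)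
  exact_mod_cast congrArg (fun r : ℝ => (r : ℂ)) h

lemma ofReal_sqrt_ne_zero (hL : 0 < L) (y : ℝ) : ((√(y ^ 2 + L ^ 2) : ℝ) : ℂ) ≠ 0 := by
  have h : 0 < √(y ^ 2 + L ^ 2) := by positivity
  exact_mod_cast h.ne'

lemma norm_unitPhase (hL : 0 < L) (y : ℝ) : ‖unitPhase L y‖ = 1 := by
  have h : 0 < √(y ^ 2 + L ^ 2) := by positivity
  rw [unitPhase, norm_div, Complex.norm_real, Real.norm_of_nonneg h.le, div_eq_one_iff_eq h.ne',
    Complex.norm_def, Complex.normSq_apply]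
  simp [sq]

lemma unitPhase_sq (hL : 0 < L) (y : ℝ) :
    unitPhase L y ^ 2
      = ((y : ℂ) - Complex.I * (L : ℂ)) / ((y : ℂ) + Complex.I * (L : ℂ)) := by
  have h1 := ofReal_add_I_mul_ne_zero hL y
  have h2 := ofReal_sqrt_ne_zero hL y
  rw [unitPhase, div_pow, div_eq_div_iff (pow_ne_zero 2 h2) h1, ofReal_sqrt_sq hL]
  linear_combination (-(L : ℂ) ^ 2 * ((y : ℂ) - Complex.I * (L : ℂ))) * Complex.I_sq

lemma uFunL_neg (hL : 0 < L) (k : ℕ) (y : ℝ) :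
    uFunL L (-(k : ℤ)) y = unitPhase L y ^ k := by
  have h1 := ofReal_add_I_mul_ne_zero hL y
  have h2 := ofReal_sqrt_ne_zero hL y
  have h3 : 0 < √(y ^ 2 + L ^ 2) := by positivity
  have hp : (y ^ 2 + L ^ 2) ^ (((-(k : ℤ) : ℤ) : ℝ) / 2) = ((√(y ^ 2 + L ^ 2)) ^ k)⁻¹ := by
    rw [Real.sqrt_eq_rpow, ← Real.rpow_mul_natCast (by positivity),
      ← Real.rpow_neg (by positivity)]
    congr 1
    push_cast
    ring
  have hz : unitPhase L y
      = ((√(y ^ 2 + L ^ 2) : ℝ) : ℂ) / ((y : ℂ) + Complex.I * (L : ℂ)) := by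
    rw [unitPhase, div_eq_div_iff h2 h1, ← sq, ofReal_sqrt_sq hL]
    linear_combination (-(L : ℂ) ^ 2) * Complex.I_sq
  rw [uFunL, hp, zpow_neg, zpow_natCast, hz, div_pow]
  push_cast
  field_simp

lemma hasDerivAt_unitPhase (hL : 0 < L) (y : ℝ) :
    HasDerivAt (unitPhase L)
      (Complex.I * L * unitPhase L y / ((y : ℂ) ^ 2 + (L : ℂ) ^ 2)) y := by
  have h2 := ofReal_sqrt_ne_zero hL y
  have hn : HasDerivAt (fun y : ℝ => (y : ℂ) - Complex.I * (L : ℂ)) 1 y :=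
    (Complex.ofRealCLM.hasDerivAt (x := y)).sub_const _
  have hR := (hasDerivAt_sqrt_sq_add_sq hL y).ofReal_comp
  have h : HasDerivAt (unitPhase L) _ y := hn.div hR h2
  refine h.congr_deriv ?_
  rw [unitPhase, ← ofReal_sqrt_sq hL]
  push_cast
  field_simp
  rw [ofReal_sqrt_sq hL]
  linear_combination ((L : ℂ) ^ 2) * Complex.I_sq

lemma hasDerivAt_unitPhase_pow (hL : 0 < L) (k : ℕ) (y : ℝ) :
    HasDerivAt (fun y => unitPhase L y ^ k)
      (Complex.I * L * k * (unitPhase L y ^ k / ((y : ℂ) ^ 2 + (L : ℂ) ^ 2))) y := by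
  refine ((hasDerivAt_unitPhase hL y).pow k).congr_deriv ?_
  rcases k with _ | k
  · simp
  · rw [Nat.add_sub_cancel, pow_succ]
    ring

lemma continuous_unitPhase (hL : 0 < L) : Continuous (unitPhase L) :=
  continuous_iff_continuousAt.2 fun y => (hasDerivAt_unitPhase hL y).continuousAt

lemma unitPhase_eq_sub (y : ℝ) :
    unitPhase L y = ((y / √(y ^ 2 + L ^ 2) : ℝ) : ℂ)
      - Complex.I * L * (((√(y ^ 2 + L ^ 2))⁻¹ : ℝ) : ℂ) := by
  rw [unitPhase]
  push_cast
  ring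

lemma tendsto_unitPhase_atTop (hL : 0 < L) : Tendsto (unitPhase L) atTop (𝓝 1) := by
  have h1 := (Complex.continuous_ofReal.tendsto _).comp (tendsto_div_sqrt_sq_add_sq_atTop hL)
  have h2 := (Complex.continuous_ofReal.tendsto _).comp (tendsto_inv_sqrt_sq_add_sq_atTop L)
  refine (Tendsto.congr (fun y => (unitPhase_eq_sub y).symm) ?_)
  simpa [Function.comp_def] using h1.sub (h2.const_mul (Complex.I * L))

lemma tendsto_unitPhase_atBot (hL : 0 < L) : Tendsto (unitPhase L) atBot (𝓝 (-1)) := by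
  have h1 := (Complex.continuous_ofReal.tendsto _).comp (tendsto_div_sqrt_sq_add_sq_atBot hL)
  have h2 := (Complex.continuous_ofReal.tendsto _).comp (tendsto_inv_sqrt_sq_add_sq_atBot L)
  refine (Tendsto.congr (fun y => (unitPhase_eq_sub y).symm) ?_)
  simpa [Function.comp_def] using h1.sub (h2.const_mul (Complex.I * L))

lemma integrable_unitPhase_pow_div (hL : 0 < L) (k : ℕ) :
    Integrable fun y : ℝ => unitPhase L y ^ k / ((y : ℂ) ^ 2 + (L : ℂ) ^ 2) := by
  have hne : ∀ y : ℝ, (y : ℂ) ^ 2 + (L : ℂ) ^ 2 ≠ 0 := fun y => by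
    rw [← ofReal_sqrt_sq hL]
    exact pow_ne_zero 2 (ofReal_sqrt_ne_zero hL y)
  have hc := continuous_unitPhase hL
  refine (integrable_inv_sq_add_sq hL).mono'
    (Continuous.aestronglyMeasurable (by fun_prop (disch := exact hne _)))
    (ae_of_all _ fun y => ?_)
  have hpos : 0 < y ^ 2 + L ^ 2 := by positivity
  have : (y : ℂ) ^ 2 + (L : ℂ) ^ 2 = ((y ^ 2 + L ^ 2 : ℝ) : ℂ) := by push_cast; rfl
  rw [this, norm_div, norm_pow, norm_unitPhase hL, Complex.norm_real,
    Real.norm_of_nonneg hpos.le, one_pow, one_div]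

lemma hasPV_unitPhase_pow_div (hL : 0 < L) (x : ℝ) (l : ℕ) :
    HasPV x (fun y : ℝ => unitPhase L y ^ (2 * l + 1) / ((y : ℂ) ^ 2 + (L : ℂ) ^ 2))
      (2 / (Complex.I * L * (2 * l + 1))) := by
  have hL' : (L : ℂ) ≠ 0 := by exact_mod_cast hL.ne'
  have hk : (2 * (l : ℂ) + 1) ≠ 0 := by exact_mod_cast (by omega : 2 * l + 1 ≠ 0)
  have hI := Complex.I_ne_zero
  have h := (HasPV.of_integrable_of_hasDerivAt (x := x)
    ((integrable_unitPhase_pow_div hL (2 * l + 1)).const_mul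
      (Complex.I * L * ((2 * l + 1 : ℕ) : ℂ)))
    (hasDerivAt_unitPhase_pow hL (2 * l + 1)) ((tendsto_unitPhase_atTop hL).pow _)
    ((tendsto_unitPhase_atBot hL).pow _)).const_mul (Complex.I * L * (2 * l + 1))⁻¹
  rw [one_pow, Odd.neg_one_pow ⟨l, rfl⟩] at h
  convert h.congr (g := fun y : ℝ =>
    unitPhase L y ^ (2 * l + 1) / ((y : ℂ) ^ 2 + (L : ℂ) ^ 2)) ?_ using 1
  · field_simp
    norm_num
  · intro y _
    push_cast
    field_simp

end UnitPhase

section BaseCase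

variable {L : ℝ}

lemma add_mul_add_sqrt_mul_sqrt_pos (hL : 0 < L) (x y : ℝ) :
    0 < L ^ 2 + x * y + √(x ^ 2 + L ^ 2) * √(y ^ 2 + L ^ 2) := by
  have h1 : |x| < √(x ^ 2 + L ^ 2) := Real.lt_sqrt_of_sq_lt (by rw [sq_abs]; nlinarith)
  have h2 : |y| < √(y ^ 2 + L ^ 2) := Real.lt_sqrt_of_sq_lt (by rw [sq_abs]; nlinarith)
  have h3 := mul_le_mul h1.le h2.le (abs_nonneg y) (Real.sqrt_nonneg _)
  rw [← abs_mul] at h3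
  nlinarith [neg_abs_le (x * y), sq_pos_of_pos hL]

/-- An antiderivative of `1/(√(y²+L²)(x-y))` off `y = x`. -/
noncomputable def invSqrtPrimitive (L x y : ℝ) : ℝ :=
  (√(x ^ 2 + L ^ 2))⁻¹ *
    Real.log ((L ^ 2 + x * y + √(x ^ 2 + L ^ 2) * √(y ^ 2 + L ^ 2)) / (y - x))

lemma hasDerivAt_invSqrtPrimitive (hL : 0 < L) {x y : ℝ} (hxy : y ≠ x) :
    HasDerivAt (invSqrtPrimitive L x) (1 / (√(y ^ 2 + L ^ 2) * (x - y))) y := by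
  have hN := add_mul_add_sqrt_mul_sqrt_pos hL x y
  have hc : 0 < √(x ^ 2 + L ^ 2) := by positivity
  have hR : 0 < √(y ^ 2 + L ^ 2) := by positivity
  have hc2 : √(x ^ 2 + L ^ 2) ^ 2 = x ^ 2 + L ^ 2 := Real.sq_sqrt (by positivity)
  have hR2 : √(y ^ 2 + L ^ 2) ^ 2 = y ^ 2 + L ^ 2 := Real.sq_sqrt (by positivity)
  have hyx : y - x ≠ 0 := sub_ne_zero.2 hxy
  have hxy' : x - y ≠ 0 := sub_ne_zero.2 hxy.symm
  have hd : HasDerivAt (fun y : ℝ => L ^ 2 + x * y + √(x ^ 2 + L ^ 2) * √(y ^ 2 + L ^ 2))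
      (x * 1 + √(x ^ 2 + L ^ 2) * (y / √(y ^ 2 + L ^ 2))) y :=
    (((hasDerivAt_id y).const_mul x).const_add (L ^ 2)).add
      ((hasDerivAt_sqrt_sq_add_sq hL y).const_mul _)
  have hq := hd.div ((hasDerivAt_id y).sub_const x) hyx
  have h := (hq.log (div_ne_zero hN.ne' hyx)).const_mul (√(x ^ 2 + L ^ 2))⁻¹
  refine h.congr_deriv ?_
  simp only [id, Pi.div_apply]
  generalize √(x ^ 2 + L ^ 2) = c at *
  generalize √(y ^ 2 + L ^ 2) = R at *
  have hN' := hN.ne'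
  rw [show x - y = -(y - x) by ring]
  field_simp
  linear_combination R * hc2 - c * hR2

lemma tendsto_invSqrtPrimitive_atTop (hL : 0 < L) (x : ℝ) :
    Tendsto (invSqrtPrimitive L x) atTop
      (𝓝 ((√(x ^ 2 + L ^ 2))⁻¹ * Real.log (√(x ^ 2 + L ^ 2) + x))) := by
  have h0 := tendsto_inv_sqrt_sq_add_sq_atTop L
  have h1 := tendsto_div_sqrt_sq_add_sq_atTop hL
  have hx : |x| < √(x ^ 2 + L ^ 2) := Real.lt_sqrt_of_sq_lt (by rw [sq_abs]; nlinarith)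
  have h := ((((h0.const_mul (L ^ 2)).add (h1.const_mul x)).add_const (√(x ^ 2 + L ^ 2))).div
    (h1.sub (h0.const_mul x)) (by norm_num)).log
      (by have := neg_abs_le x; norm_num; linarith) |>.const_mul (√(x ^ 2 + L ^ 2))⁻¹
  refine Tendsto.congr (fun y => ?_) (by convert h using 3; norm_num; ring_nf)
  have hR : 0 < √(y ^ 2 + L ^ 2) := by positivity
  rw [invSqrtPrimitive]
  congr 2
  simp only [Pi.div_apply]
  field_simp

lemma tendsto_invSqrtPrimitive_atBot (hL : 0 < L) (x : ℝ) :
    Tendsto (invSqrtPrimitive L x) atBot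
      (𝓝 ((√(x ^ 2 + L ^ 2))⁻¹ * Real.log (√(x ^ 2 + L ^ 2) - x))) := by
  have h0 := tendsto_inv_sqrt_sq_add_sq_atBot L
  have h1 := tendsto_div_sqrt_sq_add_sq_atBot hL
  have hx : |x| < √(x ^ 2 + L ^ 2) := Real.lt_sqrt_of_sq_lt (by rw [sq_abs]; nlinarith)
  have h := ((((h0.const_mul (L ^ 2)).add (h1.const_mul x)).add_const (√(x ^ 2 + L ^ 2))).div
    (h1.sub (h0.const_mul x)) (by norm_num)).log
      (by have := le_abs_self x; norm_num; intro; linarith) |>.const_mul (√(x ^ 2 + L ^ 2))⁻¹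
  refine Tendsto.congr (fun y => ?_)
    (by convert h using 3; rw [← Real.log_neg_eq_log]; norm_num; ring_nf)
  have hR : 0 < √(y ^ 2 + L ^ 2) := by positivity
  rw [invSqrtPrimitive]
  congr 2
  simp only [Pi.div_apply]
  field_simp

lemma tendsto_invSqrtPrimitive_sub (hL : 0 < L) (x : ℝ) :
    Tendsto (fun ε : ℝ => invSqrtPrimitive L x (x - ε) - invSqrtPrimitive L x (x + ε))
      (𝓝[>] 0) (𝓝 0) := by
  set N : ℝ → ℝ := fun y => L ^ 2 + x * y + √(x ^ 2 + L ^ 2) * √(y ^ 2 + L ^ 2) with hNdef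
  have hN : ∀ y, N y ≠ 0 := fun y => (add_mul_add_sqrt_mul_sqrt_pos hL x y).ne'
  have hNc : Continuous N := by fun_prop
  have hc : Continuous fun ε : ℝ =>
      (√(x ^ 2 + L ^ 2))⁻¹ * (Real.log (N (x - ε)) - Real.log (N (x + ε))) :=
    continuous_const.mul (((hNc.comp (by fun_prop)).log fun _ => hN _).sub
      ((hNc.comp (by fun_prop)).log fun _ => hN _))
  have h := (hc.tendsto 0).mono_left (nhdsWithin_le_nhds (s := Set.Ioi 0))
  simp only [sub_zero, add_zero, sub_self, mul_zero] at h
  refine h.congr' ?_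
  filter_upwards [self_mem_nhdsWithin] with ε hε
  have hε' : ε ≠ 0 := (Set.mem_Ioi.1 hε).ne'
  change _ = _ * Real.log (N (x - ε) / (x - ε - x)) - _ * Real.log (N (x + ε) / (x + ε - x))
  rw [Real.log_div (hN _) (by simpa using hε'), Real.log_div (hN _) (by simpa using hε'),
    show x - ε - x = -ε by ring, show x + ε - x = ε by ring, Real.log_neg_eq_log]
  ring

/-- An antiderivative of `1/((y²+L²)^{3/2}(x-y))` off `y = x`. -/
noncomputable def kernelPrimitive (L x y : ℝ) : ℝ :=
  (x ^ 2 + L ^ 2)⁻¹ * (invSqrtPrimitive L x y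
    + x / L ^ 2 * (y / √(y ^ 2 + L ^ 2)) - (√(y ^ 2 + L ^ 2))⁻¹)

lemma hasDerivAt_kernelPrimitive (hL : 0 < L) {x y : ℝ} (hxy : y ≠ x) :
    HasDerivAt (kernelPrimitive L x)
      (1 / ((y ^ 2 + L ^ 2) * √(y ^ 2 + L ^ 2) * (x - y))) y := by
  have hR : 0 < √(y ^ 2 + L ^ 2) := by positivity
  have hR2 : √(y ^ 2 + L ^ 2) ^ 2 = y ^ 2 + L ^ 2 := Real.sq_sqrt (by positivity)
  have hx : x ^ 2 + L ^ 2 ≠ 0 := by positivity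
  have hxy' : x - y ≠ 0 := sub_ne_zero.2 hxy.symm
  have hs := hasDerivAt_sqrt_sq_add_sq hL y
  have h := (((hasDerivAt_invSqrtPrimitive hL hxy).add
    (((hasDerivAt_id y).div hs hR.ne').const_mul (x / L ^ 2))).sub
      (hs.inv hR.ne')).const_mul (x ^ 2 + L ^ 2)⁻¹
  refine HasDerivAt.congr_deriv (f := kernelPrimitive L x) h ?_
  simp only [id]
  generalize √(y ^ 2 + L ^ 2) = R at *
  rw [← hR2]
  field_simp
  linear_combination (L ^ 2 + x * (x - y)) * hR2

lemma hasPV_kernel (hL : 0 < L) (x : ℝ) :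
    HasPV x (fun y : ℝ => ((1 / ((y ^ 2 + L ^ 2) * √(y ^ 2 + L ^ 2) * (x - y)) : ℝ) : ℂ))
      (((x ^ 2 + L ^ 2)⁻¹ * ((√(x ^ 2 + L ^ 2))⁻¹ * (Real.log (√(x ^ 2 + L ^ 2) + x)
        - Real.log (√(x ^ 2 + L ^ 2) - x)) + 2 * x / L ^ 2) : ℝ) : ℂ) := by
  have h1 : Tendsto (kernelPrimitive L x) atTop _ :=
    (((tendsto_invSqrtPrimitive_atTop hL x).add
    ((tendsto_div_sqrt_sq_add_sq_atTop hL).const_mul (x / L ^ 2))).sub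
      (tendsto_inv_sqrt_sq_add_sq_atTop L)).const_mul (x ^ 2 + L ^ 2)⁻¹
  have h2 : Tendsto (kernelPrimitive L x) atBot _ :=
    (((tendsto_invSqrtPrimitive_atBot hL x).add
    ((tendsto_div_sqrt_sq_add_sq_atBot hL).const_mul (x / L ^ 2))).sub
      (tendsto_inv_sqrt_sq_add_sq_atBot L)).const_mul (x ^ 2 + L ^ 2)⁻¹
  have hne : ∀ y : ℝ, √(y ^ 2 + L ^ 2) ≠ 0 := fun y => by positivity
  have h3 : Tendsto (fun ε : ℝ => kernelPrimitive L x (x - ε) - kernelPrimitive L x (x + ε))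
      (𝓝[>] 0) (𝓝 0) := by
    have hc : Continuous fun y : ℝ => x / L ^ 2 * (y / √(y ^ 2 + L ^ 2)) - (√(y ^ 2 + L ^ 2))⁻¹ := by
      fun_prop (disch := exact hne _)
    have hc' : Continuous fun ε : ℝ =>
        (x / L ^ 2 * ((x - ε) / √((x - ε) ^ 2 + L ^ 2)) - (√((x - ε) ^ 2 + L ^ 2))⁻¹)
          - (x / L ^ 2 * ((x + ε) / √((x + ε) ^ 2 + L ^ 2)) - (√((x + ε) ^ 2 + L ^ 2))⁻¹) :=
      (hc.comp (continuous_const.sub continuous_id)).sub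
        (hc.comp (continuous_const.add continuous_id))
    have h := ((tendsto_invSqrtPrimitive_sub hL x).add
      ((hc'.tendsto 0).mono_left (nhdsWithin_le_nhds (s := Set.Ioi 0)))).const_mul
        (x ^ 2 + L ^ 2)⁻¹
    simp only [sub_zero, add_zero, sub_self, mul_zero] at h
    refine h.congr fun ε => ?_
    simp only [kernelPrimitive]
    ring
  have hint : ∀ ε > 0, IntegrableOn
      (fun y : ℝ => ((1 / ((y ^ 2 + L ^ 2) * √(y ^ 2 + L ^ 2) * (x - y)) : ℝ) : ℂ))
      {y : ℝ | ε ≤ |x - y|} := by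
    intro ε hε
    refine Integrable.mono' ((integrable_inv_sq_add_sq hL).const_mul (L⁻¹ * ε⁻¹)).integrableOn
      (Measurable.aestronglyMeasurable (by fun_prop)) ?_
    refine ae_restrict_of_forall_mem (measurableSet_le_abs_sub x ε) fun y hy => ?_
    have hy' : ε ≤ |x - y| := hy
    have hp : 0 < y ^ 2 + L ^ 2 := by positivity
    have hLR : L ≤ √(y ^ 2 + L ^ 2) := Real.le_sqrt_of_sq_le (by nlinarith)
    rw [Complex.norm_real, Real.norm_eq_abs, abs_div, abs_one, abs_mul, abs_mul, abs_of_pos hp,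
      abs_of_nonneg (Real.sqrt_nonneg _), one_div, mul_inv, mul_inv]
    calc (y ^ 2 + L ^ 2)⁻¹ * (√(y ^ 2 + L ^ 2))⁻¹ * |x - y|⁻¹
        ≤ (y ^ 2 + L ^ 2)⁻¹ * L⁻¹ * ε⁻¹ := by gcongr
      _ = L⁻¹ * ε⁻¹ * (y ^ 2 + L ^ 2)⁻¹ := by ring
  have h := HasPV.of_hasDerivAt (F := fun y => ((kernelPrimitive L x y : ℝ) : ℂ)) hint
    (fun y hy => (hasDerivAt_kernelPrimitive hL hy).ofReal_comp)
    ((Complex.continuous_ofReal.tendsto _).comp h1)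
    ((Complex.continuous_ofReal.tendsto _).comp h2)
    (by simpa [Function.comp_def] using (Complex.continuous_ofReal.tendsto _).comp h3)
  convert h using 1
  push_cast
  ring

lemma hasPV_unitPhase_kernel_zero (hL : 0 < L) (x : ℝ) :
    HasPV x (fun y : ℝ => unitPhase L y / (((y : ℂ) ^ 2 + (L : ℂ) ^ 2) * ((x : ℂ) - y)))
      (-(2 / (L : ℂ) ^ 2) + ((x : ℂ) - Complex.I * L) *
        (((x ^ 2 + L ^ 2)⁻¹ * ((√(x ^ 2 + L ^ 2))⁻¹ * (Real.log (√(x ^ 2 + L ^ 2) + x)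
        - Real.log (√(x ^ 2 + L ^ 2) - x)) + 2 * x / L ^ 2) : ℝ) : ℂ)) := by
  have hR : ∀ y : ℝ, √(y ^ 2 + L ^ 2) ≠ 0 := fun y => by positivity
  have hint : Integrable fun y : ℝ =>
      ((-1 / ((y ^ 2 + L ^ 2) * √(y ^ 2 + L ^ 2)) : ℝ) : ℂ) := by
    refine Integrable.mono' ((integrable_inv_sq_add_sq hL).const_mul L⁻¹)
      (Measurable.aestronglyMeasurable (by fun_prop)) (ae_of_all _ fun y => ?_)
    have hp : 0 < y ^ 2 + L ^ 2 := by positivity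
    have hLR : L ≤ √(y ^ 2 + L ^ 2) := Real.le_sqrt_of_sq_le (by nlinarith)
    rw [Complex.norm_real, Real.norm_eq_abs, abs_div, abs_neg, abs_one, abs_mul, abs_of_pos hp,
      abs_of_nonneg (Real.sqrt_nonneg _), one_div, mul_inv]
    calc (y ^ 2 + L ^ 2)⁻¹ * (√(y ^ 2 + L ^ 2))⁻¹
        ≤ (y ^ 2 + L ^ 2)⁻¹ * L⁻¹ := by gcongr
      _ = L⁻¹ * (y ^ 2 + L ^ 2)⁻¹ := by ring
  have hF : ∀ y : ℝ, HasDerivAt (fun y : ℝ => (-(L ^ 2)⁻¹) * (y / √(y ^ 2 + L ^ 2)))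
      (-1 / ((y ^ 2 + L ^ 2) * √(y ^ 2 + L ^ 2))) y := by
    intro y
    have hR2 : √(y ^ 2 + L ^ 2) ^ 2 = y ^ 2 + L ^ 2 := Real.sq_sqrt (by positivity)
    have h := ((hasDerivAt_id y).div (hasDerivAt_sqrt_sq_add_sq hL y) (hR y)).const_mul
      (-(L ^ 2)⁻¹)
    refine h.congr_deriv ?_
    simp only [id]
    have := hR y
    generalize √(y ^ 2 + L ^ 2) = R at *
    rw [← hR2]
    field_simp
    linear_combination -hR2
  have h1 := HasPV.of_integrable_of_hasDerivAt (x := x) hint (fun y => (hF y).ofReal_comp)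
    ((Complex.continuous_ofReal.tendsto _).comp
      ((tendsto_div_sqrt_sq_add_sq_atTop hL).const_mul (-(L ^ 2)⁻¹)))
    ((Complex.continuous_ofReal.tendsto _).comp
      ((tendsto_div_sqrt_sq_add_sq_atBot hL).const_mul (-(L ^ 2)⁻¹)))
  convert (h1.add ((hasPV_kernel hL x).const_mul ((x : ℂ) - Complex.I * L))).congr ?_ using 1
  · push_cast
    ring
  · intro y hy
    have h2 := ofReal_sqrt_ne_zero hL y
    have h3 : (y : ℂ) ^ 2 + (L : ℂ) ^ 2 ≠ 0 := by
      rw [← ofReal_sqrt_sq hL]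
      exact pow_ne_zero 2 h2
    have h4 : (x : ℂ) - y ≠ 0 := sub_ne_zero.2 (by exact_mod_cast hy.symm)
    rw [unitPhase]
    push_cast
    field_simp
    ring

end BaseCase

/-- Passing from frequency `2l+1` to `2l+3` multiplies the kernel by the square of the phase at `x`,
up to an integrable error. -/
lemma HasPV.unitPhase_kernel_succ {L x : ℝ} (hL : 0 < L) {l : ℕ} {w : ℂ}
    (h : HasPV x (fun y : ℝ => unitPhase L y ^ (2 * l + 1)
      / (((y : ℂ) ^ 2 + (L : ℂ) ^ 2) * ((x : ℂ) - y))) w) :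
    HasPV x (fun y : ℝ => unitPhase L y ^ (2 * (l + 1) + 1)
      / (((y : ℂ) ^ 2 + (L : ℂ) ^ 2) * ((x : ℂ) - y)))
      (unitPhase L x ^ 2 * w - ((x : ℂ) + Complex.I * L)⁻¹ *
        (2 / (Complex.I * L * (2 * l + 1)) - 2 / (Complex.I * L * (2 * l + 3)))) := by
  have h1 := hasPV_unitPhase_pow_div hL x l
  have h2 := hasPV_unitPhase_pow_div hL x (l + 1)
  convert (((h.const_mul (unitPhase L x ^ 2)).add
    (h1.const_mul (-((x : ℂ) + Complex.I * L)⁻¹))).add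
    (h2.const_mul (((x : ℂ) + Complex.I * L)⁻¹))).congr ?_ using 1
  · push_cast
    ring
  · intro y hy
    have hx1 := ofReal_add_I_mul_ne_zero hL x
    have hy1 := ofReal_add_I_mul_ne_zero hL y
    have h3 : (y : ℂ) ^ 2 + (L : ℂ) ^ 2 ≠ 0 := by
      rw [← ofReal_sqrt_sq hL]
      exact pow_ne_zero 2 (ofReal_sqrt_ne_zero hL y)
    have h4 : (x : ℂ) - y ≠ 0 := sub_ne_zero.2 (by exact_mod_cast hy.symm)
    have e : ∀ z : ℂ, z ^ (2 * (l + 1) + 1) = z ^ 2 * z ^ (2 * l + 1) := fun z => by ring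
    simp only [e]
    rw [unitPhase_sq hL, unitPhase_sq hL]
    field_simp
    ring

section Cotangent

variable {L s : ℝ}

lemma sqrt_mul_cot_sq_add_sq (hL : 0 < L) (hs : s ∈ Set.Ioo 0 Real.pi) :
    √((L * Real.cot s) ^ 2 + L ^ 2) = L / Real.sin s := by
  have hsin : 0 < Real.sin s := Real.sin_pos_of_mem_Ioo hs
  rw [show (L * Real.cot s) ^ 2 + L ^ 2 = (L / Real.sin s) ^ 2 by
    rw [Real.cot_eq_cos_div_sin]
    field_simp
    linear_combination Real.sin_sq_add_cos_sq s, Real.sqrt_sq (by positivity)]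

lemma log_sub_log_eq_two_mul_log_cot_half (hL : 0 < L) (hs : s ∈ Set.Ioo 0 Real.pi) :
    Real.log (L / Real.sin s + L * Real.cot s) - Real.log (L / Real.sin s - L * Real.cot s)
      = 2 * Real.log (Real.cot (s / 2)) := by
  have hsin : 0 < Real.sin s := Real.sin_pos_of_mem_Ioo hs
  have h1 : 0 < Real.sin (s / 2) :=
    Real.sin_pos_of_mem_Ioo ⟨by linarith [hs.1], by linarith [hs.1, hs.2]⟩
  have h2 : 0 < Real.cos (s / 2) :=
    Real.cos_pos_of_mem_Ioo ⟨by linarith [hs.1, Real.pi_pos], by linarith [hs.2]⟩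
  have hc : Real.cos s = 2 * Real.cos (s / 2) ^ 2 - 1 := by
    rw [← Real.cos_two_mul]; ring_nf
  have hc2 := Real.sin_sq_add_cos_sq (s / 2)
  have e1 : L / Real.sin s + L * Real.cot s = L / Real.sin s * 2 * Real.cos (s / 2) ^ 2 := by
    rw [Real.cot_eq_cos_div_sin, hc]
    ring
  have e2 : L / Real.sin s - L * Real.cot s = L / Real.sin s * 2 * Real.sin (s / 2) ^ 2 := by
    rw [Real.cot_eq_cos_div_sin, hc]
    linear_combination (-2 * L / Real.sin s) * hc2
  rw [e1, e2, ← Real.log_div (by positivity) (by positivity), Real.cot_eq_cos_div_sin,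
    mul_div_mul_left _ _ (by positivity), ← div_pow, Real.log_pow]
  norm_num

lemma ofReal_sub_I_mul_eq (hs : s ∈ Set.Ioo 0 Real.pi) :
    ((L * Real.cot s : ℝ) : ℂ) - Complex.I * L
      = L / Real.sin s * Complex.exp (-Complex.I * s) := by
  have hsin : (Real.sin s : ℂ) ≠ 0 := by exact_mod_cast (Real.sin_pos_of_mem_Ioo hs).ne'
  rw [show -Complex.I * (s : ℂ) = -(s : ℂ) * Complex.I by ring, Complex.exp_mul_I,
    Complex.cos_neg, Complex.sin_neg, Real.cot_eq_cos_div_sin]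
  push_cast at hsin ⊢
  field_simp
  ring

lemma unitPhase_mul_cot (hL : 0 < L) (hs : s ∈ Set.Ioo 0 Real.pi) :
    unitPhase L (L * Real.cot s) = Complex.exp (-Complex.I * s) := by
  have hsin : (Real.sin s : ℂ) ≠ 0 := by exact_mod_cast (Real.sin_pos_of_mem_Ioo hs).ne'
  have hL' : (L : ℂ) ≠ 0 := by exact_mod_cast hL.ne'
  rw [unitPhase, sqrt_mul_cot_sq_add_sq hL hs, ofReal_sub_I_mul_eq hs, Complex.ofReal_div]
  field_simp

lemma inv_ofReal_add_I_mul (hL : 0 < L) (hs : s ∈ Set.Ioo 0 Real.pi) :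
    (((L * Real.cot s : ℝ) : ℂ) + Complex.I * L)⁻¹
      = (1 - Complex.exp (-Complex.I * s) ^ 2) / (2 * Complex.I * L) := by
  have hL' : (L : ℂ) ≠ 0 := by exact_mod_cast hL.ne'
  have h := ofReal_add_I_mul_ne_zero hL (L * Real.cot s)
  rw [← unitPhase_mul_cot hL hs, unitPhase_sq hL]
  have hI := Complex.I_ne_zero
  field_simp
  ring

/-- `∑_{j ≤ l} q^j / ((2(j-l)-3)(2(j-l)-1)(2(j-l)+1))`. -/
noncomputable def cubicSum (q : ℂ) (l : ℕ) : ℂ :=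
  ∑ j ∈ Finset.range (l + 1),
    q ^ j / ((2 * ((j : ℂ) - l) - 3) * (2 * ((j : ℂ) - l) - 1) * (2 * ((j : ℂ) - l) + 1))

lemma cubicSum_succ (q : ℂ) (l : ℕ) :
    cubicSum q (l + 1)
      = q * cubicSum q l - 1 / ((2 * (l : ℂ) + 5) * (2 * l + 3) * (2 * l + 1)) := by
  rw [cubicSum, Finset.sum_range_succ', cubicSum, Finset.mul_sum,
    sub_eq_add_neg _ (1 / _), ← div_neg,
    Nat.cast_zero, pow_zero,
    show (2 * ((0 : ℂ) - (l + 1 : ℕ)) - 3) * (2 * (0 - (l + 1 : ℕ)) - 1)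
      * (2 * (0 - (l + 1 : ℕ)) + 1) = -((2 * (l : ℂ) + 5) * (2 * l + 3) * (2 * l + 1)) by
        push_cast; ring, add_left_inj]
  refine Finset.sum_congr rfl fun j _ => ?_
  push_cast
  rw [show (j : ℂ) + 1 - (l + 1) = j - l by ring]
  ring

lemma hasPV_unitPhase_kernel (hL : 0 < L) (hs : s ∈ Set.Ioo 0 Real.pi) (l : ℕ) :
    HasPV (L * Real.cot s) (fun y : ℝ => unitPhase L y ^ (2 * l + 1)
      / (((y : ℂ) ^ 2 + (L : ℂ) ^ 2) * (((L * Real.cot s : ℝ) : ℂ) - y)))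
      ((2 * Complex.exp (-Complex.I * s) ^ (2 * l + 1)
          * ((Real.cos s + (Real.sin s) ^ 2 * Real.log (Real.cot (s / 2)) : ℝ) : ℂ)
        + 2 / ((2 * l + 1) * (2 * l + 3))
        - 8 * cubicSum (Complex.exp (-Complex.I * s) ^ 2) l) / (L : ℂ) ^ 2) := by
  have hsin : (Real.sin s : ℂ) ≠ 0 := by exact_mod_cast (Real.sin_pos_of_mem_Ioo hs).ne'
  have hL' : (L : ℂ) ≠ 0 := by exact_mod_cast hL.ne'
  induction l with
  | zero =>
    have h := hasPV_unitPhase_kernel_zero hL (L * Real.cot s)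
    have hsq : (L * Real.cot s) ^ 2 + L ^ 2 = (L / Real.sin s) ^ 2 := by
      rw [← sqrt_mul_cot_sq_add_sq hL hs, Real.sq_sqrt (by positivity)]
    rw [sqrt_mul_cot_sq_add_sq hL hs, log_sub_log_eq_two_mul_log_cot_half hL hs, hsq,
      ofReal_sub_I_mul_eq hs] at h
    convert h using 1
    · simp
    · rw [Real.cot_eq_cos_div_sin s]
      simp only [cubicSum, Finset.sum_range_one, zero_add]
      push_cast at hsin ⊢
      field_simp
      ring
  | succ l ih =>
    convert ih.unitPhase_kernel_succ hL using 1
    rw [unitPhase_mul_cot hL hs, inv_ofReal_add_I_mul hL hs, cubicSum_succ]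
    have h1 : (2 * (l : ℂ) + 1) ≠ 0 := by exact_mod_cast (by omega : 2 * l + 1 ≠ 0)
    have h3 : (2 * (l : ℂ) + 3) ≠ 0 := by exact_mod_cast (by omega : 2 * l + 3 ≠ 0)
    have h5 : (2 * (l : ℂ) + 5) ≠ 0 := by exact_mod_cast (by omega : 2 * l + 5 ≠ 0)
    have e1 : (2 * ((l + 1 : ℕ) : ℂ) + 1) = 2 * l + 3 := by push_cast; ring
    have e3 : (2 * ((l + 1 : ℕ) : ℂ) + 3) = 2 * l + 5 := by push_cast; ring
    rw [e1, e3, show 2 * (l + 1) + 1 = 2 * l + 1 + 2 by ring, pow_add]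
    generalize Complex.exp (-Complex.I * s) ^ (2 * l + 1) = p
    generalize Complex.exp (-Complex.I * s) = z
    generalize ((Real.cos s + (Real.sin s) ^ 2 * Real.log (Real.cot (s / 2)) : ℝ) : ℂ) = Q
    generalize cubicSum (z ^ 2) l = S
    have hI := Complex.I_ne_zero
    field_simp
    rw [Complex.I_sq]
    ring

end Cotangent

/-- The first `M + 1` entries of the cyclic convolution, as a genuine convolution. -/
lemma cyclic_convolution_eq {M P : ℕ} (hP : 2 * M + 1 ≤ P) (a bt ct : ℕ → ℂ)
    (hbt : ∀ l, bt l = if l ≤ M then (8 * (l : ℂ) + 4) * a l else 0)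
    (hct : ∀ l, ct l = if l = 0 then 1 / 3 else if l ≤ P - M - 1 then 0
      else 1 / ((2 * ((l : ℂ) - (P : ℂ)) - 3) * (2 * ((l : ℂ) - (P : ℂ)) - 1)
        * (2 * ((l : ℂ) - (P : ℂ)) + 1)))
    {l : ℕ} (hl : l ≤ M) :
    ∑ n ∈ Finset.range P, bt n * ct ((((l : ℤ) - (n : ℤ)) % (P : ℤ)).toNat)
      = ∑ n ∈ Finset.range (M + 1), if l ≤ n then (8 * (n : ℂ) + 4) * a n
        / ((2 * ((l : ℂ) - n) - 3) * (2 * ((l : ℂ) - n) - 1) * (2 * ((l : ℂ) - n) + 1)) else 0 := by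
  have hsub : Finset.range (M + 1) ⊆ Finset.range P := by
    intro n hn
    simp only [Finset.mem_range] at *
    omega
  rw [← Finset.sum_subset hsub fun n _ hn => by
    rw [hbt, if_neg (by simpa using hn), zero_mul]]
  refine Finset.sum_congr rfl fun n hn => ?_
  have hn' : n ≤ M := by simpa [Nat.lt_succ_iff] using hn
  rw [hbt, if_pos hn', hct]
  rcases lt_trichotomy l n with h | h | h
  · have e : (((l : ℤ) - (n : ℤ)) % (P : ℤ)).toNat = l + P - n := by
      rw [← Int.add_emod_right, Int.emod_eq_of_lt (by omega) (by omega)]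
      omega
    rw [e, if_neg (by omega), if_neg (by omega), if_pos h.le, Nat.cast_sub (by omega)]
    push_cast
    rw [show (l : ℂ) + P - n - P = l - n by ring]
    ring
  · subst h
    simp
    ring
  · have e : (((l : ℤ) - (n : ℤ)) % (P : ℤ)).toNat = l - n := by
      rw [Int.emod_eq_of_lt (by omega) (by omega)]
      omega
    rw [e, if_neg (by omega), if_pos (by omega), if_neg (by omega), mul_zero]

lemma sum_cyclic_convolution_mul_pow {M P : ℕ} (hP : 2 * M + 1 ≤ P) (a bt ct : ℕ → ℂ)
    (hbt : ∀ l, bt l = if l ≤ M then (8 * (l : ℂ) + 4) * a l else 0)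
    (hct : ∀ l, ct l = if l = 0 then 1 / 3 else if l ≤ P - M - 1 then 0
      else 1 / ((2 * ((l : ℂ) - (P : ℂ)) - 3) * (2 * ((l : ℂ) - (P : ℂ)) - 1)
        * (2 * ((l : ℂ) - (P : ℂ)) + 1))) (q : ℂ) :
    ∑ l ∈ Finset.range (M + 1),
        (∑ n ∈ Finset.range P, bt n * ct ((((l : ℤ) - (n : ℤ)) % (P : ℤ)).toNat)) * q ^ l
      = ∑ n ∈ Finset.range (M + 1), (8 * (n : ℂ) + 4) * a n * cubicSum q n := by
  have h : ∀ l ∈ Finset.range (M + 1),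
      (∑ n ∈ Finset.range P, bt n * ct ((((l : ℤ) - (n : ℤ)) % (P : ℤ)).toNat)) * q ^ l
        = ∑ n ∈ Finset.range (M + 1), if l ≤ n then (8 * (n : ℂ) + 4) * a n * (q ^ l
        / ((2 * ((l : ℂ) - n) - 3) * (2 * ((l : ℂ) - n) - 1) * (2 * ((l : ℂ) - n) + 1)))
          else 0 := by
    intro l hl
    rw [cyclic_convolution_eq hP a bt ct hbt hct (by simpa [Nat.lt_succ_iff] using hl),
      Finset.sum_mul]
    refine Finset.sum_congr rfl fun n _ => ?_
    split_ifs
    · ring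
    · ring
  rw [Finset.sum_congr rfl h, Finset.sum_comm]
  refine Finset.sum_congr rfl fun n hn => ?_
  rw [cubicSum, Finset.mul_sum, ← Finset.sum_filter]
  refine Finset.sum_congr ?_ fun _ _ => rfl
  ext l
  simp only [Finset.mem_filter, Finset.mem_range] at *
  omega

/-- Fast-convolution formula for negative odd frequencies: for `L > 0`, `M ∈ ℕ`,
`a₀,…,a_M ∈ ℂ`, `s ∈ (0,π)`, `x = L·cot s` and `P ≥ 2M+1`, with `b̃`, `c̃` and the cyclic
convolution `(b̃∗c̃)_l = ∑_{n=0}^{P−1} b̃_n c̃_{(l−n) mod P}` as in the statement, the values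
`v_l = (1/π)·PV∫ u_{−(2l+1)}'(y)/(x−y) dy` all exist and satisfy
`∑_{l=0}^{M} a_l v_l = (2i/(Lπ))∑ a_l/(2l+3) − (2i/(Lπ))∑ (b̃∗c̃)_l e^{−i2ls}
 + (2i/(Lπ))(cos s + sin² s·ln(cot(s/2)))∑ (2l+1)a_l e^{−i(2l+1)s}`. -/
theorem fast_convolution_halfLaplacian_neg (L : ℝ) (hL : 0 < L) (M : ℕ) (a : ℕ → ℂ)
    (s : ℝ) (hs : s ∈ Set.Ioo 0 Real.pi) (x : ℝ) (hx : x = L * Real.cot s)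
    (P : ℕ) (hP : 2 * M + 1 ≤ P) (bt ct : ℕ → ℂ)
    (hbt : ∀ l, bt l = if l ≤ M then (8 * (l : ℂ) + 4) * a l else 0)
    (hct : ∀ l, ct l = if l = 0 then 1 / 3 else if l ≤ P - M - 1 then 0
      else 1 / ((2 * ((l : ℂ) - (P : ℂ)) - 3) * (2 * ((l : ℂ) - (P : ℂ)) - 1)
        * (2 * ((l : ℂ) - (P : ℂ)) + 1))) :
    ∃ v : ℕ → ℂ,
      (∀ l ∈ Finset.range (M + 1),
        Tendsto (fun ε : ℝ => (1 / (Real.pi : ℂ)) *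
            ∫ y in {y : ℝ | ε ≤ |x - y|},
              deriv (uFunL L (-(2 * (l : ℤ) + 1))) y / ((x : ℂ) - (y : ℂ)))
          (nhdsWithin 0 (Set.Ioi 0)) (nhds (v l)))
      ∧ ∑ l ∈ Finset.range (M + 1), a l * v l
        = (2 * Complex.I / ((L : ℂ) * (Real.pi : ℂ)))
              * ∑ l ∈ Finset.range (M + 1), a l / (2 * (l : ℂ) + 3)
          - (2 * Complex.I / ((L : ℂ) * (Real.pi : ℂ)))
              * ∑ l ∈ Finset.range (M + 1),
                  (∑ n ∈ Finset.range P, bt n * ct ((((l : ℤ) - (n : ℤ)) % (P : ℤ)).toNat))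
                    * Complex.exp (-Complex.I * 2 * (l : ℂ) * (s : ℂ))
          + (2 * Complex.I / ((L : ℂ) * (Real.pi : ℂ)))
              * ((Real.cos s + (Real.sin s) ^ 2 * Real.log (Real.cot (s / 2)) : ℝ) : ℂ)
              * ∑ l ∈ Finset.range (M + 1),
                  (2 * (l : ℂ) + 1) * a l
                    * Complex.exp (-Complex.I * (2 * (l : ℂ) + 1) * (s : ℂ)) := by
  subst hx
  have hpi : (Real.pi : ℂ) ≠ 0 := by exact_mod_cast Real.pi_ne_zero
  have hL' : (L : ℂ) ≠ 0 := by exact_mod_cast hL.ne'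
  set z := Complex.exp (-Complex.I * s) with hz
  set Q : ℂ := ((Real.cos s + (Real.sin s) ^ 2 * Real.log (Real.cot (s / 2)) : ℝ) : ℂ) with hQ
  refine ⟨fun l => 1 / Real.pi * (Complex.I * L * (2 * l + 1) * ((2 * z ^ (2 * l + 1) * Q
    + 2 / ((2 * l + 1) * (2 * l + 3)) - 8 * cubicSum (z ^ 2) l) / (L : ℂ) ^ 2)),
    fun l _ => ?_, ?_⟩
  · have hu : uFunL L (-(2 * (l : ℤ) + 1)) = fun y => unitPhase L y ^ (2 * l + 1) :=
      funext fun y => by rw [← uFunL_neg hL]; push_cast; rfl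
    have h := (hasPV_unitPhase_kernel hL hs l).const_mul (Complex.I * L * (2 * l + 1))
    refine ((h.congr (g := fun y : ℝ => deriv (uFunL L (-(2 * (l : ℤ) + 1))) y
      / (((L * Real.cot s : ℝ) : ℂ) - (y : ℂ))) fun y _ => ?_).2).const_mul _
    rw [hu, (hasDerivAt_unitPhase_pow hL _ y).deriv, ← div_div]
    push_cast
    ring
  · have e1 : ∀ l : ℕ, Complex.exp (-Complex.I * 2 * (l : ℂ) * (s : ℂ)) = (z ^ 2) ^ l := by
      intro l
      rw [hz, ← pow_mul, ← Complex.exp_nat_mul]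
      congr 1
      push_cast
      ring
    have e2 : ∀ l : ℕ, Complex.exp (-Complex.I * (2 * (l : ℂ) + 1) * (s : ℂ))
        = z ^ (2 * l + 1) := by
      intro l
      rw [hz, ← Complex.exp_nat_mul]
      congr 1
      push_cast
      ring
    simp only [e1, e2]
    rw [sum_cyclic_convolution_mul_pow hP a bt ct hbt hct, Finset.mul_sum, Finset.mul_sum,
      Finset.mul_sum, ← Finset.sum_sub_distrib, ← Finset.sum_add_distrib]
    refine Finset.sum_congr rfl fun l _ => ?_
    have h1 : (2 * (l : ℂ) + 1) ≠ 0 := by exact_mod_cast (by omega : 2 * l + 1 ≠ 0)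
    have h3 : (2 * (l : ℂ) + 3) ≠ 0 := by exact_mod_cast (by omega : 2 * l + 3 ≠ 0)
    field_simp
    ring
end

section
/- For every x ∈ ℝ, the principal value (1/π)·PV∫ u'(y)/(x−y) dy with u(y) = 1/(1+y⁴) exists and equals (1−x²)(x⁴+4x²+1)/(√2·(1+x⁴)²); that is, the half Laplacian of 1/(1+x⁴) equals (1−x²)(x⁴+4x²+1)/(√2(1+x⁴)²). -/
open Filter MeasureTheory

lemma hasDerivAt_one_div_one_add_pow_four (y : ℝ) :
    HasDerivAt (fun y : ℝ => 1 / (1 + y ^ 4)) (-4 * y ^ 3 / (1 + y ^ 4) ^ 2) y := by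
  have h : HasDerivAt (fun y : ℝ => 1 + y ^ 4) (4 * y ^ 3) y := by
    simpa using (hasDerivAt_pow 4 y).const_add 1
  simpa [one_div, neg_mul] using h.fun_inv (by positivity : (1 : ℝ) + y ^ 4 ≠ 0)

lemma abs_deriv_one_div_one_add_pow_four_le (y : ℝ) :
    |-4 * y ^ 3 / (1 + y ^ 4) ^ 2| ≤ 8 * (1 + y ^ 2)⁻¹ := by
  have h3 : |y| ^ 3 ≤ 1 + y ^ 4 := by
    rw [← Even.pow_abs (by decide : Even 4) y]
    nlinarith [abs_nonneg y, sq_nonneg (|y| ^ 2 - 1), sq_nonneg (|y| ^ 2 - |y|),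
      sq_nonneg (|y| - 1)]
  have h2 : 1 + y ^ 2 ≤ 2 * (1 + y ^ 4) := by nlinarith [sq_nonneg (y ^ 2 - 1)]
  rw [abs_div, abs_mul, abs_pow, abs_of_pos (by positivity : (0 : ℝ) < (1 + y ^ 4) ^ 2),
    ← div_eq_mul_inv, div_le_div_iff₀ (by positivity) (by positivity)]
  have := mul_le_mul h3 h2 (by positivity) (by positivity)
  norm_num
  nlinarith

lemma integrable_deriv_one_div_one_add_pow_four :
    Integrable fun y : ℝ => -4 * y ^ 3 / (1 + y ^ 4) ^ 2 := by
  refine (integrable_inv_one_add_sq.const_mul 8).mono' ?_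
    (ae_of_all _ abs_deriv_one_div_one_add_pow_four_le)
  exact (by fun_prop : Measurable fun y : ℝ => -4 * y ^ 3 / (1 + y ^ 4) ^ 2).aestronglyMeasurable

lemma integrableOn_deriv_div_sub {x ε : ℝ} (hε : 0 < ε) :
    IntegrableOn (fun y : ℝ => -4 * y ^ 3 / (1 + y ^ 4) ^ 2 / (x - y)) {y | ε ≤ |x - y|} := by
  have hs : MeasurableSet {y : ℝ | ε ≤ |x - y|} :=
    measurableSet_le measurable_const (by fun_prop)
  refine (integrable_deriv_one_div_one_add_pow_four.abs.div_const ε).integrableOn.mono' ?_ ?_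
  · exact (by fun_prop : Measurable fun y : ℝ =>
      -4 * y ^ 3 / (1 + y ^ 4) ^ 2 / (x - y)).aestronglyMeasurable
  · refine (ae_restrict_iff' hs).2 (ae_of_all _ fun y hy => ?_)
    rw [norm_div, Real.norm_eq_abs, Real.norm_eq_abs]
    exact div_le_div_of_nonneg_left (abs_nonneg _) hε hy

/-- The part of the antiderivative of `y ↦ u'(y)/(x-y)`, for `u(y) = 1/(1+y⁴)`, which is smooth
at `x`. -/
noncomputable def regularPrimitive (x y : ℝ) : ℝ :=
  (x ^ 3 + x ^ 2 * y + x * y ^ 2 + y ^ 3) / ((1 + x ^ 4) * (1 + y ^ 4)) +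
    1 / (1 + x ^ 4) ^ 2 *
      (-x ^ 3 * Real.log (1 + y ^ 4) + (x - x ^ 5) * Real.arctan (y ^ 2) +
        (3 * x ^ 2 - x ^ 6 - (1 - 3 * x ^ 4)) / (4 * √2) *
          Real.log ((y ^ 2 + √2 * y + 1) / (y ^ 2 - √2 * y + 1)) +
        (1 - x ^ 2) * (x ^ 4 + 4 * x ^ 2 + 1) / (2 * √2) *
          (Real.arctan (√2 * y + 1) + Real.arctan (√2 * y - 1)))

/-- An antiderivative of `y ↦ u'(y)/(x-y)`, for `u(y) = 1/(1+y⁴)`, away from `x`. -/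
noncomputable def singularPrimitive (x y : ℝ) : ℝ :=
  regularPrimitive x y + 4 * x ^ 3 / (1 + x ^ 4) ^ 2 * Real.log (y - x)

lemma sq_add_sqrt_two_mul_pos (y : ℝ) : 0 < y ^ 2 + √2 * y + 1 := by
  nlinarith [sq_nonneg (y + √2 / 2), Real.sq_sqrt (zero_le_two (α := ℝ))]

lemma sq_sub_sqrt_two_mul_pos (y : ℝ) : 0 < y ^ 2 - √2 * y + 1 := by
  nlinarith [sq_nonneg (y - √2 / 2), Real.sq_sqrt (zero_le_two (α := ℝ))]

lemma one_add_pow_four_eq_mul (y : ℝ) :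
    1 + y ^ 4 = (y ^ 2 + √2 * y + 1) * (y ^ 2 - √2 * y + 1) := by
  linear_combination y ^ 2 * Real.sq_sqrt (zero_le_two (α := ℝ))

lemma hasDerivAt_log_quotient (y : ℝ) :
    HasDerivAt (fun y : ℝ => Real.log ((y ^ 2 + √2 * y + 1) / (y ^ 2 - √2 * y + 1)))
      (2 * √2 * (1 - y ^ 2) / (1 + y ^ 4)) y := by
  have hp := (sq_add_sqrt_two_mul_pos y).ne'
  have hm := (sq_sub_sqrt_two_mul_pos y).ne'
  have h1 : HasDerivAt (fun y : ℝ => y ^ 2 + √2 * y + 1) (2 * y + √2) y := by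
    simpa using ((hasDerivAt_pow 2 y).add ((hasDerivAt_id y).const_mul √2)).add_const 1
  have h2 : HasDerivAt (fun y : ℝ => y ^ 2 - √2 * y + 1) (2 * y - √2) y := by
    simpa using ((hasDerivAt_pow 2 y).sub ((hasDerivAt_id y).const_mul √2)).add_const 1
  refine HasDerivAt.congr_deriv ((h1.fun_div h2 hm).log (div_ne_zero hp hm)) ?_
  rw [one_add_pow_four_eq_mul]
  field_simp
  ring

lemma hasDerivAt_arctan_add_arctan (y : ℝ) :
    HasDerivAt (fun y : ℝ => Real.arctan (√2 * y + 1) + Real.arctan (√2 * y - 1))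
      (√2 * (1 + y ^ 2) / (1 + y ^ 4)) y := by
  have hp := (sq_add_sqrt_two_mul_pos y).ne'
  have hm := (sq_sub_sqrt_two_mul_pos y).ne'
  have hs := Real.sq_sqrt (zero_le_two (α := ℝ))
  have h1 : HasDerivAt (fun y : ℝ => √2 * y + 1) √2 y := by
    simpa using ((hasDerivAt_id y).const_mul √2).add_const 1
  have h2 : HasDerivAt (fun y : ℝ => √2 * y - 1) √2 y := by
    simpa using ((hasDerivAt_id y).const_mul √2).sub_const 1
  refine HasDerivAt.congr_deriv (h1.arctan.fun_add h2.arctan) ?_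
  have e1 : 1 + (√2 * y + 1) ^ 2 = 2 * (y ^ 2 + √2 * y + 1) := by linear_combination y ^ 2 * hs
  have e2 : 1 + (√2 * y - 1) ^ 2 = 2 * (y ^ 2 - √2 * y + 1) := by linear_combination y ^ 2 * hs
  have e3 : 1 + y ^ 2 = (y ^ 2 + √2 * y + 1 + (y ^ 2 - √2 * y + 1)) / 2 := by ring
  rw [one_add_pow_four_eq_mul, e1, e2, e3]
  generalize y ^ 2 + √2 * y + 1 = a at hp
  generalize y ^ 2 - √2 * y + 1 = b at hm
  field_simp
  ring

lemma hasDerivAt_regularPrimitive (x y : ℝ) :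
    HasDerivAt (regularPrimitive x)
      ((x ^ 2 + 2 * x * y + 3 * y ^ 2) / ((1 + x ^ 4) * (1 + y ^ 4)) -
        4 * y ^ 3 * (x ^ 3 + x ^ 2 * y + x * y ^ 2 + y ^ 3) / ((1 + x ^ 4) * (1 + y ^ 4) ^ 2) +
        (3 * x ^ 2 - x ^ 6 + (2 * x - 2 * x ^ 5) * y + (1 - 3 * x ^ 4) * y ^ 2 - 4 * x ^ 3 * y ^ 3) /
          ((1 + x ^ 4) ^ 2 * (1 + y ^ 4))) y := by
  have hX : (1 : ℝ) + x ^ 4 ≠ 0 := by positivity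
  have hY : (1 : ℝ) + y ^ 4 ≠ 0 := by positivity
  have hs2 : √2 ≠ 0 := by positivity
  have hD : HasDerivAt (fun y : ℝ => 1 + y ^ 4) (4 * y ^ 3) y := by
    simpa using (hasDerivAt_pow 4 y).const_add 1
  have hS : HasDerivAt (fun y : ℝ => x ^ 3 + x ^ 2 * y + x * y ^ 2 + y ^ 3)
      (x ^ 2 + 2 * x * y + 3 * y ^ 2) y := by
    refine HasDerivAt.congr_deriv (((((hasDerivAt_id y).const_mul (x ^ 2)).const_add (x ^ 3)).fun_add
      ((hasDerivAt_pow 2 y).const_mul x)).fun_add (hasDerivAt_pow 3 y)) ?_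
    simp
    ring
  have hA : HasDerivAt (fun y : ℝ => Real.arctan (y ^ 2)) (2 * y / (1 + y ^ 4)) y := by
    refine HasDerivAt.congr_deriv ((hasDerivAt_pow 2 y).arctan) ?_
    rw [← pow_mul]
    simp
    ring
  refine HasDerivAt.congr_deriv ((hS.fun_div (hD.const_mul (1 + x ^ 4)) (mul_ne_zero hX hY)).fun_add
    (((((hD.log hY).const_mul (-x ^ 3)).fun_add (hA.const_mul (x - x ^ 5))).fun_add
      ((hasDerivAt_log_quotient y).const_mul
        ((3 * x ^ 2 - x ^ 6 - (1 - 3 * x ^ 4)) / (4 * √2)))).fun_add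
      ((hasDerivAt_arctan_add_arctan y).const_mul
        ((1 - x ^ 2) * (x ^ 4 + 4 * x ^ 2 + 1) / (2 * √2))) |>.const_mul
      (1 / (1 + x ^ 4) ^ 2))) ?_
  field_simp
  ring

lemma hasDerivAt_singularPrimitive {x y : ℝ} (hxy : x ≠ y) :
    HasDerivAt (singularPrimitive x) (-4 * y ^ 3 / (1 + y ^ 4) ^ 2 / (x - y)) y := by
  have hX : (1 : ℝ) + x ^ 4 ≠ 0 := by positivity
  have hY : (1 : ℝ) + y ^ 4 ≠ 0 := by positivity
  have h1 : x - y ≠ 0 := sub_ne_zero.2 hxy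
  have h2 : y - x ≠ 0 := sub_ne_zero.2 hxy.symm
  refine HasDerivAt.congr_deriv ((hasDerivAt_regularPrimitive x y).fun_add
    ((((hasDerivAt_id y).sub_const x).log h2).const_mul (4 * x ^ 3 / (1 + x ^ 4) ^ 2))) ?_
  have e : (1 : ℝ) / (id y - x) = -(1 / (x - y)) := by
    rw [id, ← neg_sub x y, div_neg]
  rw [e]
  field_simp
  ring

lemma tendsto_singularPrimitive {x c : ℝ} {l : Filter ℝ}
    (hinv : Tendsto (fun y : ℝ => y⁻¹) l (nhds 0)) (hne : ∀ᶠ y in l, y ≠ 0 ∧ y ≠ x)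
    (hsq : Tendsto (fun y : ℝ => y ^ 2) l atTop)
    (hp : Tendsto (fun y : ℝ => Real.arctan (√2 * y + 1)) l (nhds c))
    (hm : Tendsto (fun y : ℝ => Real.arctan (√2 * y - 1)) l (nhds c)) :
    Tendsto (singularPrimitive x) l (nhds (1 / (1 + x ^ 4) ^ 2 *
      ((x - x ^ 5) * (Real.pi / 2) +
        (1 - x ^ 2) * (x ^ 4 + 4 * x ^ 2 + 1) / (2 * √2) * (c + c)))) := by
  have lift (g : ℝ → ℝ) (hg : ContinuousAt g 0) : Tendsto (fun y => g y⁻¹) l (nhds (g 0)) :=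
    hg.tendsto.comp hinv
  have hR : Tendsto (fun y : ℝ => (x ^ 3 + x ^ 2 * y + x * y ^ 2 + y ^ 3) /
      ((1 + x ^ 4) * (1 + y ^ 4))) l (nhds 0) := by
    have h := lift (fun t => (x ^ 3 * t ^ 4 + x ^ 2 * t ^ 3 + x * t ^ 2 + t) /
      ((1 + x ^ 4) * (t ^ 4 + 1))) (by
        refine ContinuousAt.div (by fun_prop) (by fun_prop) ?_
        positivity)
    simp only [ne_eq, OfNat.ofNat_ne_zero, not_false_eq_true, zero_pow, mul_zero, add_zero,
      zero_div] at h
    refine h.congr' (hne.mono fun y hy => ?_)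
    have := hy.1
    have hY : (1 : ℝ) + y ^ 4 ≠ 0 := by positivity
    have hX : (1 : ℝ) + x ^ 4 ≠ 0 := by positivity
    field_simp
  have hA : Tendsto (fun y : ℝ => Real.arctan (y ^ 2)) l (nhds (Real.pi / 2)) :=
    (Real.tendsto_arctan_atTop.mono_right nhdsWithin_le_nhds).comp hsq
  have hL : Tendsto (fun y : ℝ => Real.log ((y ^ 2 + √2 * y + 1) / (y ^ 2 - √2 * y + 1))) l
      (nhds 0) := by
    have h := lift (fun t => Real.log ((1 + √2 * t + t ^ 2) / (1 - √2 * t + t ^ 2))) (by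
      refine ContinuousAt.log (ContinuousAt.div (by fun_prop) (by fun_prop) ?_) ?_ <;> simp)
    simp only [ne_eq, OfNat.ofNat_ne_zero, not_false_eq_true, zero_pow, mul_zero, add_zero,
      sub_zero, div_one, Real.log_one] at h
    refine h.congr' (hne.mono fun y hy => ?_)
    have := hy.1
    have hm := (sq_sub_sqrt_two_mul_pos y).ne'
    congr 1
    rw [← mul_div_mul_left _ _ (pow_ne_zero 2 this)]
    congr 1 <;> field_simp
  have hS : Tendsto (fun y : ℝ => Real.log (1 + y ^ 4) - 4 * Real.log (y - x)) l (nhds 0) := by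
    have h := lift (fun t => Real.log ((t ^ 4 + 1) / (1 - x * t) ^ 4)) (by
      refine ContinuousAt.log (ContinuousAt.div (by fun_prop) (by fun_prop) ?_) ?_ <;> simp)
    simp only [ne_eq, OfNat.ofNat_ne_zero, not_false_eq_true, zero_pow, mul_zero, zero_add,
      sub_zero, one_pow, div_one, Real.log_one] at h
    refine h.congr' (hne.mono fun y hy => ?_)
    have h0 := hy.1
    have h1 : y - x ≠ 0 := sub_ne_zero.2 hy.2
    beta_reduce
    have e : (4 : ℝ) * Real.log (y - x) = Real.log ((y - x) ^ 4) := by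
      rw [Real.log_pow]; norm_num
    rw [e, ← Real.log_div (by positivity) (pow_ne_zero 4 h1),
      ← mul_div_mul_left _ _ (pow_ne_zero 4 h0), ← mul_pow]
    congr 2
    · field_simp
    · field_simp
  have key := hR.add (((((hS.const_mul (-x ^ 3)).add (hA.const_mul (x - x ^ 5))).add
    (hL.const_mul ((3 * x ^ 2 - x ^ 6 - (1 - 3 * x ^ 4)) / (4 * √2)))).add
    ((hp.add hm).const_mul ((1 - x ^ 2) * (x ^ 4 + 4 * x ^ 2 + 1) / (2 * √2)))).const_mul
    (1 / (1 + x ^ 4) ^ 2))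
  simp only [mul_zero, zero_add, add_zero] at key
  refine key.congr fun y => ?_
  simp only [singularPrimitive, regularPrimitive]
  ring

lemma tendsto_singularPrimitive_atTop (x : ℝ) :
    Tendsto (singularPrimitive x) atTop (nhds (1 / (1 + x ^ 4) ^ 2 *
      ((x - x ^ 5) * (Real.pi / 2) + (1 - x ^ 2) * (x ^ 4 + 4 * x ^ 2 + 1) / (2 * √2) *
        (Real.pi / 2 + Real.pi / 2)))) := by
  have hlin : Tendsto (fun y : ℝ => √2 * y) atTop atTop :=
    tendsto_id.const_mul_atTop (by positivity)
  have harc := Real.tendsto_arctan_atTop.mono_right nhdsWithin_le_nhds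
  exact tendsto_singularPrimitive tendsto_inv_atTop_zero
    ((eventually_ne_atTop 0).and (eventually_ne_atTop x)) (tendsto_pow_atTop two_ne_zero)
    (harc.comp (tendsto_atTop_add_const_right _ 1 hlin))
    (harc.comp (tendsto_atTop_add_const_right _ (-1) hlin))

lemma tendsto_singularPrimitive_atBot (x : ℝ) :
    Tendsto (singularPrimitive x) atBot (nhds (1 / (1 + x ^ 4) ^ 2 *
      ((x - x ^ 5) * (Real.pi / 2) + (1 - x ^ 2) * (x ^ 4 + 4 * x ^ 2 + 1) / (2 * √2) *
        (-(Real.pi / 2) + -(Real.pi / 2))))) := by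
  have hlin : Tendsto (fun y : ℝ => √2 * y) atBot atBot :=
    tendsto_id.const_mul_atBot (by positivity)
  have harc := Real.tendsto_arctan_atBot.mono_right nhdsWithin_le_nhds
  exact tendsto_singularPrimitive tendsto_inv_atBot_zero
    ((eventually_ne_atBot 0).and (eventually_ne_atBot x))
    (by simpa [Function.comp_def] using
      (tendsto_pow_atTop (α := ℝ) two_ne_zero).comp tendsto_abs_atBot_atTop)
    (harc.comp (tendsto_atBot_add_const_right _ 1 hlin))
    (harc.comp (tendsto_atBot_add_const_right _ (-1) hlin))

lemma setOf_le_abs_sub_eq_union {x ε : ℝ} :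
    {y : ℝ | ε ≤ |x - y|} = Set.Iic (x - ε) ∪ Set.Ici (x + ε) := by
  ext y
  simp only [Set.mem_ofPred_eq, Set.mem_union, Set.mem_Iic, Set.mem_Ici, le_abs]
  constructor <;> rintro (h | h) <;> [left; right; left; right] <;> linarith

lemma setIntegral_deriv_div_sub {x ε : ℝ} (hε : 0 < ε) :
    ∫ y in {y : ℝ | ε ≤ |x - y|}, -4 * y ^ 3 / (1 + y ^ 4) ^ 2 / (x - y) =
      regularPrimitive x (x - ε) - regularPrimitive x (x + ε) +
        Real.pi * ((1 - x ^ 2) * (x ^ 4 + 4 * x ^ 2 + 1) / (√2 * (1 + x ^ 4) ^ 2)) := by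
  have hint := integrableOn_deriv_div_sub (x := x) hε
  rw [setOf_le_abs_sub_eq_union] at hint ⊢
  have hl := hint.mono_set Set.subset_union_left
  have hr := hint.mono_set Set.subset_union_right
  have hdisj : Disjoint (Set.Iic (x - ε)) (Set.Ici (x + ε)) :=
    Set.Iic_disjoint_Ici.2 (by linarith)
  rw [setIntegral_union hdisj measurableSet_Ici hl hr, integral_Ici_eq_integral_Ioi,
    integral_Iic_of_hasDerivAt_of_tendsto'
      (fun y hy => hasDerivAt_singularPrimitive
        (ne_of_gt (by linarith [Set.mem_Iic.1 hy])))
      hl (tendsto_singularPrimitive_atBot x),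
    integral_Ioi_of_hasDerivAt_of_tendsto'
      (fun y hy => hasDerivAt_singularPrimitive
        (ne_of_lt (by linarith [Set.mem_Ici.1 hy])))
      (hr.mono_set Set.Ioi_subset_Ici_self) (tendsto_singularPrimitive_atTop x)]
  have e : Real.log (x - ε - x) = Real.log (x + ε - x) := by
    rw [show x - ε - x = -(x + ε - x) by ring, Real.log_neg_eq_log]
  have hX : (1 : ℝ) + x ^ 4 ≠ 0 := by positivity
  simp only [singularPrimitive, e]
  field_simp
  ring

/-- For every `x ∈ ℝ`, the half Laplacian of `u(y) = 1/(1+y⁴)`, i.e. the principal value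
`(1/π)·PV∫ u'(y)/(x−y) dy`, exists and equals `(1−x²)(x⁴+4x²+1)/(√2(1+x⁴)²)`. -/
theorem halfLaplacian_one_div_one_add_pow_four (x : ℝ) :
    Tendsto (fun ε : ℝ => (1 / Real.pi) *
        ∫ y in {y : ℝ | ε ≤ |x - y|},
          deriv (fun y : ℝ => 1 / (1 + y ^ 4)) y / (x - y))
      (nhdsWithin 0 (Set.Ioi 0))
      (nhds ((1 - x ^ 2) * (x ^ 4 + 4 * x ^ 2 + 1) / (Real.sqrt 2 * (1 + x ^ 4) ^ 2))) := by
  simp only [(hasDerivAt_one_div_one_add_pow_four _).deriv]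
  have hG : Continuous (regularPrimitive x) :=
    continuous_iff_continuousAt.2 fun y => (hasDerivAt_regularPrimitive x y).continuousAt
  have hcont : Continuous fun ε : ℝ => (1 / Real.pi) *
      (regularPrimitive x (x - ε) - regularPrimitive x (x + ε) +
        Real.pi * ((1 - x ^ 2) * (x ^ 4 + 4 * x ^ 2 + 1) / (√2 * (1 + x ^ 4) ^ 2))) := by
    fun_prop
  have h := (hcont.tendsto 0).mono_left (nhdsWithin_le_nhds (s := Set.Ioi 0))
  rw [sub_zero, add_zero, sub_self, zero_add, ← mul_assoc, one_div_mul_cancel Real.pi_ne_zero,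
    one_mul] at h
  refine h.congr' (eventually_nhdsWithin_of_forall fun ε hε => ?_)
  exact congrArg _ (setIntegral_deriv_div_sub hε).symm
end
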